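/- Let k ≥ 6 be an even integer, let f be a cusp form of weight k for Γ₀(3), and let ε ∈ {1, −1} be such that f is an Atkin–Lehner eigenform, i.e. 3^{−k/2}·z^{−k}·f(−1/(3z)) = ε·f(z) for all z in the upper half-plane, and f satisfies the newform relation (1/3)·(f(z/3) + f((z+1)/3) + f((z+2)/3)) = −ε·3^{(k−2)/2}·f(z) for all z in the upper half-plane. Then for every pair (n₁,n₂) ∈ oo(k), Σ_{(m₁,m₂)∈oo(k)} a_{m₁,m₂}(f)·dc³((m₁,m₂),(n₁,n₂)) = −(1/2)·(1 + ε·3^{−(k−2)/2})·a_{n₂,n₁}(f). -/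

import Mathlib

open Complex MeasureTheory CongruenceSubgroup

noncomputable section

/-- Evaluation of a function on the upper half-plane at a complex number,
extended by `0` off the upper half-plane. -/
def fval (f : UpperHalfPlane → ℂ) (z : ℂ) : ℂ :=
  if h : 0 < z.im then f ⟨z, h⟩ else 0

/-- The totally odd index set `oo(k)`: pairs of odd integers `≥ 3` summing to `k`. -/
def oo (k : ℕ) : Finset (ℕ × ℕ) :=
  (Finset.range (k + 1) ×ˢ Finset.range (k + 1)).filter
    (fun p => Odd p.1 ∧ Odd p.2 ∧ 3 ≤ p.1 ∧ 3 ≤ p.2 ∧ p.1 + p.2 = k)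

/-- The coefficient `a_{m₁,m₂}(f) = C(k-2, m₁-1) ⬝ i^{m₁} ⬝ ∫_0^∞ f(it) t^{m₁-1} dt`
of `x^{m₂-1} y^{m₁-1}` in the period polynomial of `f` (it only depends on `m₁` and `k`). -/
def periodCoeff (k : ℕ) (f : UpperHalfPlane → ℂ) (m₁ : ℕ) : ℂ :=
  (Nat.choose (k - 2) (m₁ - 1) : ℂ) * I ^ m₁ *
    ∫ t in Set.Ioi (0 : ℝ), fval f (I * t) * (t : ℂ) ^ (m₁ - 1)

/-- Integer binomial coefficient with the convention `C(a,b) = 0` unless `0 ≤ b ≤ a`. -/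
def ichoose (a b : ℤ) : ℤ :=
  if 0 ≤ b ∧ b ≤ a then (a.toNat).choose b.toNat else 0

/-- `e((m₁,m₂),(n₁,n₂)) = (-1)^{n₁} C(m₁-1, m₁-n₁) + (-1)^{m₁-n₂} C(m₁-1, m₁-n₂)`. -/
def eEntry (m n : ℕ × ℕ) : ℚ :=
  (-1 : ℚ) ^ (n.1 : ℤ) * (ichoose ((m.1 : ℤ) - 1) ((m.1 : ℤ) - (n.1 : ℤ)) : ℚ) +
  (-1 : ℚ) ^ ((m.1 : ℤ) - (n.2 : ℤ)) * (ichoose ((m.1 : ℤ) - 1) ((m.1 : ℤ) - (n.2 : ℤ)) : ℚ)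

/-- Kronecker delta on index pairs. -/
def deltaEntry (m n : ℕ × ℕ) : ℚ := if m = n then 1 else 0

/-- The entry `dc³((m₁,m₂),(n₁,n₂))` of the matrix `D³_{k,2} ⬝ C³_{k,2}`. -/
def dc3Entry (m n : ℕ × ℕ) : ℚ :=
  (((3 : ℚ) ^ (1 - (m.2 : ℤ)) - 1) / 2) * deltaEntry m n + eEntry m n

/-- Holomorphic functions on the upper half-plane that decay exponentially towards `i∞`,
uniformly on vertical strips. -/
def IsRapid (H : ℂ → ℂ) : Prop :=
  DifferentiableOn ℂ H {z | 0 < z.im} ∧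
    ∀ R y₀ : ℝ, 0 < y₀ → ∃ C c : ℝ, 0 ≤ C ∧ 0 < c ∧ ∀ z : ℂ, |z.re| ≤ R → y₀ ≤ z.im →
      ‖H z‖ ≤ C * Real.exp (-c * z.im)

theorem isOpen_upperHalf : IsOpen {z : ℂ | 0 < z.im} :=
  isOpen_lt continuous_const Complex.continuous_im

theorem IsRapid.derivative {H : ℂ → ℂ} (hH : IsRapid H) : IsRapid (deriv H) := by
  refine ⟨hH.1.deriv isOpen_upperHalf, fun R y₀ hy₀ => ?_⟩
  obtain ⟨C, c, hC0, hc, hC⟩ := hH.2 (R + y₀ / 2) (y₀ / 2) (by positivity)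
  refine ⟨C * Real.exp (c * (y₀ / 2)) / (y₀ / 2), c, by positivity, hc, fun z hz hzi => ?_⟩
  have hball : ∀ w ∈ Metric.closedBall z (y₀ / 2),
      |w.re| ≤ R + y₀ / 2 ∧ z.im - y₀ / 2 ≤ w.im := by
    intro w hw
    rw [mem_closedBall_iff_norm] at hw
    have h1 := (Complex.abs_re_le_norm (w - z)).trans hw
    have h2 := (Complex.abs_im_le_norm (w - z)).trans hw
    simp only [Complex.sub_re, Complex.sub_im] at h1 h2
    rw [abs_le] at *
    constructor
    · constructor <;> linarith
    · linarith
  have hd : DiffContOnCl ℂ H (Metric.ball z (y₀ / 2)) := by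
    apply DifferentiableOn.diffContOnCl
    rw [closure_ball _ (by positivity)]
    refine hH.1.mono fun w hw => ?_
    have := (hball w hw).2
    simp only [Set.mem_ofPred_eq]
    linarith
  have := Complex.norm_deriv_le_of_forall_mem_sphere_norm_le (by positivity) hd
    (C := C * Real.exp (c * (y₀ / 2)) * Real.exp (-c * z.im)) fun w hw => by
      obtain ⟨h1, h2⟩ := hball w (Metric.sphere_subset_closedBall hw)
      refine (hC w h1 (by linarith)).trans ?_
      rw [mul_assoc, ← Real.exp_add]
      gcongr
      nlinarith
  calc _ ≤ _ := this
    _ = _ := by ring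

theorem IsRapid.mul_linear_pow {h : ℂ → ℂ} (hh : IsRapid h) (w : ℕ) (x y : ℂ) :
    IsRapid fun z => h z * (z * y - x) ^ w := by
  refine ⟨hh.1.mul (by fun_prop), fun R y₀ hy₀ => ?_⟩
  obtain ⟨C, c, hC0, hc, hC⟩ := hh.2 R y₀ hy₀
  set s : ℝ := c / 2 / (‖y‖ + 1) with hs
  have hs0 : 0 < s := by positivity
  refine ⟨C * ((s ^ w)⁻¹ * w.factorial * Real.exp (s * (R * ‖y‖ + ‖x‖))), c / 2,
    by positivity, by positivity, fun z hz hzi => ?_⟩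
  have hlin : ‖z * y - x‖ ≤ (R + z.im) * ‖y‖ + ‖x‖ := by
    calc ‖z * y - x‖ ≤ ‖z‖ * ‖y‖ + ‖x‖ := by
          rw [← norm_mul]; exact norm_sub_le _ _
      _ ≤ _ := by
        gcongr
        have := Complex.norm_le_abs_re_add_abs_im z
        rw [abs_of_pos (hy₀.trans_le hzi)] at this
        linarith
  have hexp : ‖z * y - x‖ ^ w ≤
      (s ^ w)⁻¹ * w.factorial * Real.exp (s * (R * ‖y‖ + ‖x‖)) * Real.exp (c / 2 * z.im) := by
    have h1 := Real.pow_div_factorial_le_exp (s * ‖z * y - x‖) (by positivity) w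
    have h2 : s * ‖z * y - x‖ ≤ s * (R * ‖y‖ + ‖x‖) + c / 2 * z.im := by
      have h3 : s * ‖y‖ ≤ c / 2 := by
        rw [hs, div_mul_eq_mul_div, div_le_iff₀ (by positivity)]
        nlinarith [norm_nonneg y]
      nlinarith [mul_le_mul_of_nonneg_left hlin hs0.le,
        mul_le_mul_of_nonneg_right h3 (hy₀.trans_le hzi).le]
    have h4 := h1.trans (Real.exp_le_exp.2 h2)
    rw [div_le_iff₀ (by positivity), mul_pow, Real.exp_add] at h4
    calc ‖z * y - x‖ ^ w = (s ^ w)⁻¹ * (s ^ w * ‖z * y - x‖ ^ w) := by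
          field_simp
      _ ≤ (s ^ w)⁻¹ * (Real.exp (s * (R * ‖y‖ + ‖x‖)) * Real.exp (c / 2 * z.im) *
          w.factorial) := by gcongr
      _ = _ := by ring
  rw [norm_mul, norm_pow]
  calc _ ≤ C * Real.exp (-c * z.im) * ((s ^ w)⁻¹ * w.factorial *
        Real.exp (s * (R * ‖y‖ + ‖x‖)) * Real.exp (c / 2 * z.im)) := by
        gcongr
        exact hC z hz hzi
    _ = C * ((s ^ w)⁻¹ * w.factorial * Real.exp (s * (R * ‖y‖ + ‖x‖))) *
        (Real.exp (-c * z.im) * Real.exp (c / 2 * z.im)) := by ring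
    _ = C * ((s ^ w)⁻¹ * w.factorial * Real.exp (s * (R * ‖y‖ + ‖x‖))) *
        Real.exp (-(c / 2) * z.im) := by
        rw [← Real.exp_add]
        ring_nf

theorem IsRapid.const_mul_comp_div_three {h : ℂ → ℂ} (hh : IsRapid h) (a : ℂ) :
    IsRapid fun z => a * h (z / 3) := by
  have him : ∀ z : ℂ, (z / 3).im = z.im / 3 := fun z => Complex.div_ofNat_im z 3
  have hre : ∀ z : ℂ, (z / 3).re = z.re / 3 := fun z => Complex.div_ofNat_re z 3
  refine ⟨(hh.1.comp (by fun_prop) fun z hz => ?_).const_mul a, fun R y₀ hy₀ => ?_⟩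
  · simp only [Set.mem_ofPred_eq, him] at hz ⊢
    positivity
  · obtain ⟨C, c, hC0, hc, hC⟩ := hh.2 (R / 3) (y₀ / 3) (by positivity)
    refine ⟨‖a‖ * C, c / 3, by positivity, by positivity, fun z hz hzi => ?_⟩
    have := hC (z / 3) (by rw [hre, abs_div, abs_of_pos (three_pos : (0 : ℝ) < 3)]; gcongr)
      (by rw [him]; gcongr)
    rw [norm_mul, mul_assoc]
    gcongr
    rwa [him, show -c * (z.im / 3) = -(c / 3) * z.im by ring] at this

theorem IsRapid.continuousOn {H : ℂ → ℂ} (hH : IsRapid H) {τ : ℂ} (hτ : 0 < τ.im) :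
    ContinuousOn (fun t : ℝ => H (τ + I * t)) (Set.Ici 0) := by
  refine hH.1.continuousOn.comp (by fun_prop) fun t ht => ?_
  have : 0 ≤ t := ht
  simp
  linarith

theorem IsRapid.norm_vertical_le {H : ℂ → ℂ} (hH : IsRapid H) {τ₀ : ℂ} (hτ₀ : 0 < τ₀.im) :
    ∃ C c : ℝ, 0 < c ∧ ∀ τ ∈ Metric.ball τ₀ (τ₀.im / 2), 0 < τ.im ∧ ∀ t : ℝ, 0 ≤ t →
      ‖H (τ + I * t)‖ ≤ C * Real.exp (-c * t) := by
  obtain ⟨C, c, hC0, hc, hC⟩ := hH.2 (|τ₀.re| + τ₀.im / 2) (τ₀.im / 2) (by positivity)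
  refine ⟨C, c, hc, fun τ hτ => ?_⟩
  rw [mem_ball_iff_norm] at hτ
  have h1 := (Complex.abs_re_le_norm (τ - τ₀)).trans hτ.le
  have h2 := (Complex.abs_im_le_norm (τ - τ₀)).trans hτ.le
  rw [Complex.sub_re] at h1
  rw [Complex.sub_im, abs_le] at h2
  refine ⟨by linarith, fun t ht => ?_⟩
  refine (hC _ ?_ ?_).trans ?_
  · have := abs_sub_abs_le_abs_sub τ.re τ₀.re
    simp
    linarith
  · simp
    linarith
  · refine mul_le_mul_of_nonneg_left (Real.exp_le_exp.2 ?_) hC0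
    simp
    nlinarith

theorem IsRapid.integrableOn {H : ℂ → ℂ} (hH : IsRapid H) {τ : ℂ} (hτ : 0 < τ.im) :
    IntegrableOn (fun t : ℝ => H (τ + I * t)) (Set.Ioi 0) := by
  obtain ⟨C, c, hc, hC⟩ := hH.norm_vertical_le hτ
  refine Integrable.mono' ((exp_neg_integrableOn_Ioi 0 hc).const_mul C)
    (((hH.continuousOn hτ).mono Set.Ioi_subset_Ici_self).aestronglyMeasurable measurableSet_Ioi)
    ((ae_restrict_iff' measurableSet_Ioi).2 (.of_forall fun t ht => ?_))
  exact (hC τ (Metric.mem_ball_self (by positivity))).2 t (le_of_lt ht)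

/-- The integral of `H` along the vertical half-line from `τ` to `τ + i∞`. -/
def verticalIntegral (H : ℂ → ℂ) (τ : ℂ) : ℂ :=
  ∫ t in Set.Ioi (0 : ℝ), H (τ + I * t) * I

theorem IsRapid.hasDerivAt_verticalIntegral {H : ℂ → ℂ} (hH : IsRapid H) {τ : ℂ}
    (hτ : 0 < τ.im) : HasDerivAt (verticalIntegral H) (-H τ) τ := by
  have hpos : ∀ σ : ℂ, 0 < σ.im → ∀ t : ℝ, 0 ≤ t → 0 < (σ + I * t).im := by
    intro σ hσ t ht
    simp
    linarith
  have hder : ∀ σ : ℂ, 0 < σ.im → ∀ t : ℝ, 0 ≤ t →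
      HasDerivAt H (deriv H (σ + I * t)) (σ + I * t) := fun σ hσ t ht =>
    (hH.1.differentiableAt (isOpen_upperHalf.mem_nhds (hpos σ hσ t ht))).hasDerivAt
  obtain ⟨C, c, hc, hC⟩ := hH.derivative.norm_vertical_le hτ
  have key := hasDerivAt_integral_of_dominated_loc_of_deriv_le
    (μ := volume.restrict (Set.Ioi (0 : ℝ)))
    (F := fun σ t => H (σ + I * t) * I) (F' := fun σ t => deriv H (σ + I * t) * I)
    (bound := fun t => C * Real.exp (-c * t)) (Metric.ball_mem_nhds τ (half_pos hτ))
    ?_ ((hH.integrableOn hτ).mul_const I) ((hH.derivative.integrableOn hτ).mul_const I).1 ?_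
    ((exp_neg_integrableOn_Ioi 0 hc).const_mul C) ?_
  · have hint : ∫ t in Set.Ioi (0 : ℝ), deriv H (τ + I * t) * I = 0 - H (τ + I * (0 : ℝ)) := by
      refine integral_Ioi_of_hasDerivAt_of_tendsto (f := fun t : ℝ => H (τ + I * t))
        (hH.continuousOn hτ 0 Set.self_mem_Ici) (fun t ht => ?_)
        ((hH.derivative.integrableOn hτ).mul_const I) ?_
      · have h1 : HasDerivAt (fun t : ℝ => τ + I * (t : ℂ)) I t := by
          simpa using ((Complex.ofRealCLM.hasDerivAt (x := t)).const_mul I).const_add τ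
        exact (hder τ hτ t (le_of_lt ht)).comp t h1
      · obtain ⟨C, c, hc, hC⟩ := hH.norm_vertical_le hτ
        have h0 : Filter.Tendsto (fun t : ℝ => C * Real.exp (-c * t)) Filter.atTop (nhds 0) := by
          rw [← mul_zero C]
          refine (Real.tendsto_exp_atBot.comp ?_).const_mul C
          exact Filter.tendsto_id.const_mul_atTop_of_neg (neg_lt_zero.2 hc)
        refine squeeze_zero_norm' ?_ h0
        filter_upwards [Filter.eventually_ge_atTop 0] with t ht
        exact (hC τ (Metric.mem_ball_self (half_pos hτ))).2 t ht
    have h2 := key.2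
    rw [hint] at h2
    simpa using! h2
  · filter_upwards [isOpen_upperHalf.mem_nhds hτ] with σ hσ
    exact ((hH.integrableOn hσ).mul_const I).1
  · refine (ae_restrict_iff' measurableSet_Ioi).2 (.of_forall fun t ht σ hσ => ?_)
    simpa using (hC σ hσ).2 t (le_of_lt ht)
  · refine (ae_restrict_iff' measurableSet_Ioi).2 (.of_forall fun t ht σ hσ => ?_)
    exact ((hder σ (hC σ hσ).1 t (le_of_lt ht)).comp_add_const σ (I * t)).mul_const I

theorem fval_of_im_pos (f : UpperHalfPlane → ℂ) (τ : UpperHalfPlane) : fval f τ = f τ := by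
  simp [fval, τ.im_pos]

theorem fval_eqOn_comp_ofComplex (f : UpperHalfPlane → ℂ) :
    Set.EqOn (fval f) (f ∘ UpperHalfPlane.ofComplex) {z | 0 < z.im} := by
  intro z hz
  have hz' : 0 < z.im := hz
  simp [fval, hz', UpperHalfPlane.ofComplex_apply_of_im_pos hz']

theorem one_mem_strictPeriods_Gamma0 (N : ℕ) :
    (1 : ℝ) ∈ (Gamma0 N : Subgroup (GL (Fin 2) ℝ)).strictPeriods := by
  rw [strictPeriods_Gamma0]
  exact AddSubgroup.mem_zmultiples 1

theorem fval_add_one {N : ℕ} {k : ℤ} (f : CuspForm (Gamma0 N) k) {z : ℂ} (hz : 0 < z.im) :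
    fval f (z + 1) = fval f z := by
  have hz' : z + 1 ∈ {z : ℂ | 0 < z.im} := by simpa using hz
  rw [fval_eqOn_comp_ofComplex _ hz', fval_eqOn_comp_ofComplex _ hz]
  exact_mod_cast SlashInvariantFormClass.periodic_comp_ofComplex f
    (one_mem_strictPeriods_Gamma0 N) z

theorem isRapid_fval {N : ℕ} [NeZero N] {k : ℕ} (f : CuspForm (Gamma0 N) (k : ℤ)) :
    IsRapid (fval f) := by
  refine ⟨(UpperHalfPlane.mdifferentiable_iff.1 f.holo').congr (fval_eqOn_comp_ofComplex f),
    fun R y₀ hy₀ => ?_⟩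
  obtain ⟨C, hC⟩ := CuspFormClass.exists_bound f
  obtain ⟨D, hD⟩ := Asymptotics.isBigO_iff.1
    (CuspFormClass.exp_decay_atImInfty f one_pos (one_mem_strictPeriods_Gamma0 N))
  obtain ⟨A, hA⟩ := (UpperHalfPlane.atImInfty_mem _).1 hD
  set c : ℝ := 2 * Real.pi
  have hc : 0 < c := by positivity
  refine ⟨max |D| (|C| / y₀ ^ ((k : ℝ) / 2) * Real.exp (c * A)), c, by positivity, hc,
    fun z _ hzi => ?_⟩
  have hz : 0 < z.im := hy₀.trans_le hzi
  lift z to UpperHalfPlane using hz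
  rw [fval_of_im_pos]
  by_cases h : A ≤ z.im
  · refine (hA z h).trans ?_
    rw [Real.norm_of_nonneg (Real.exp_pos _).le]
    refine mul_le_mul ((le_abs_self D).trans (le_max_left _ _)) (le_of_eq ?_)
      (Real.exp_pos _).le (by positivity)
    simp [c]
  · push Not at h
    refine (hC z).trans ?_
    calc C / z.im ^ (((k : ℤ) : ℝ) / 2) ≤ |C| / y₀ ^ ((k : ℝ) / 2) * 1 := by
          rw [mul_one]
          refine div_le_div₀ (abs_nonneg _) (le_abs_self _) (by positivity) ?_
          rw [Int.cast_natCast]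
          exact Real.rpow_le_rpow hy₀.le hzi (by positivity)
      _ ≤ |C| / y₀ ^ ((k : ℝ) / 2) * (Real.exp (c * A) * Real.exp (-c * z.im)) := by
          gcongr
          rw [← Real.exp_add]
          apply Real.one_le_exp
          nlinarith
      _ ≤ _ := by
          rw [← mul_assoc]
          exact mul_le_mul_of_nonneg_right (le_max_right _ _) (Real.exp_pos _).le

theorem integral_Ioi_eq_add_inv {F : ℝ → ℂ}
    (h₁ : IntegrableOn (fun s => F (1 + s)) (Set.Ioi 0))
    (h₂ : IntegrableOn (fun s => (((1 + s) ^ 2)⁻¹ : ℝ) • F (1 + s)⁻¹) (Set.Ioi 0)) :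
    IntegrableOn F (Set.Ioi 0) ∧ ∫ t in Set.Ioi 0, F t =
      (∫ s in Set.Ioi 0, F (1 + s)) +
        ∫ s in Set.Ioi 0, (((1 + s) ^ 2)⁻¹ : ℝ) • F (1 + s)⁻¹ := by
  have him₁ : (fun s : ℝ => 1 + s) '' Set.Ioi 0 = Set.Ioi 1 := by simp
  have him₂ : (fun s : ℝ => (1 + s)⁻¹) '' Set.Ioi 0 = Set.Ioo 0 1 := by
    rw [← Set.image_image (fun s : ℝ => s⁻¹), him₁, Set.image_inv_eq_inv, Set.inv_Ioi₀ one_pos,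
      inv_one]
  have hd₁ : ∀ s ∈ Set.Ioi (0 : ℝ), HasDerivWithinAt (fun s : ℝ => 1 + s) 1 (Set.Ioi 0) s :=
    fun s _ => ((hasDerivAt_id s).const_add 1).hasDerivWithinAt
  have hd₂ : ∀ s ∈ Set.Ioi (0 : ℝ),
      HasDerivWithinAt (fun s : ℝ => (1 + s)⁻¹) (-1 / (1 + s) ^ 2) (Set.Ioi 0) s :=
    fun s hs => (((hasDerivAt_id s).const_add 1).inv
      (by have : 0 < s := hs; simp only [id]; positivity)).hasDerivWithinAt
  have hinj₁ : Set.InjOn (fun s : ℝ => 1 + s) (Set.Ioi 0) := fun a _ b _ h => by simpa using h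
  have hinj₂ : Set.InjOn (fun s : ℝ => (1 + s)⁻¹) (Set.Ioi 0) := fun a _ b _ h => by
    simpa using h
  have habs : ∀ s : ℝ, |-1 / (1 + s) ^ 2| = ((1 + s) ^ 2)⁻¹ := fun s => by
    rw [abs_div, abs_neg, abs_one, abs_of_nonneg (by positivity), one_div]
  have hi₁ := integrableOn_image_iff_integrableOn_abs_deriv_smul measurableSet_Ioi hd₁ hinj₁ F
  have hi₂ := integrableOn_image_iff_integrableOn_abs_deriv_smul measurableSet_Ioi hd₂ hinj₂ F
  have he₁ := integral_image_eq_integral_abs_deriv_smul measurableSet_Ioi hd₁ hinj₁ F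
  have he₂ := integral_image_eq_integral_abs_deriv_smul measurableSet_Ioi hd₂ hinj₂ F
  simp only [him₁, him₂, habs, abs_one, one_smul] at hi₁ hi₂ he₁ he₂
  have hI₁ := hi₁.2 h₁
  have hI₂ := (integrableOn_Ioc_iff_integrableOn_Ioo).2 (hi₂.2 h₂)
  rw [← he₁, ← he₂, ← Set.Ioc_union_Ioi_eq_Ioi (zero_le_one' ℝ)]
  refine ⟨hI₂.union hI₁, ?_⟩
  rw [setIntegral_union (Set.Ioc_disjoint_Ioi le_rfl) measurableSet_Ioi hI₂ hI₁,
    integral_Ioc_eq_integral_Ioo, add_comm]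

/-- The integral of `h(z) (z y - x) ^ w` along the vertical half-line from `τ` to `τ + i∞`. -/
def eichlerIntegral (h : ℂ → ℂ) (w : ℕ) (x y τ : ℂ) : ℂ :=
  verticalIntegral (fun z => h z * (z * y - x) ^ w) τ

/-- The period polynomial `∫_0^{i∞} h(z) (z y - x) ^ w dz`. -/
def periodPoly (h : ℂ → ℂ) (w : ℕ) (x y : ℂ) : ℂ :=
  ∫ t in Set.Ioi (0 : ℝ), h (I * t) * (I * t * y - x) ^ w * I

section

variable {f g : ℂ → ℂ} {w : ℕ}

theorem im_neg_one_div_pos {τ : ℂ} (hτ : 0 < τ.im) : 0 < (-1 / τ).im := by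
  have h0 : τ ≠ 0 := by rintro rfl; simp at hτ
  rw [neg_div, one_div, Complex.neg_im, Complex.inv_im, neg_div, neg_neg]
  exact div_pos hτ (Complex.normSq_pos.2 h0)

theorem I_mul_inv_eq (s : ℝ) : I * (((1 + s)⁻¹ : ℝ) : ℂ) = -1 / (I + I * s) := by
  rw [← mul_one_add, neg_div, one_div, mul_inv, Complex.inv_I]
  push_cast
  ring

theorem periodPoly_eq_at_I (hf : IsRapid f) (hg : IsRapid g) (hw : Even w)
    (hfg : ∀ z : ℂ, 0 < z.im → f (-1 / z) = z ^ (w + 2) * g z) (x y : ℂ) :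
    periodPoly f w x y = eichlerIntegral f w x y I - eichlerIntegral g w (-y) x (-1 / I) := by
  have e₁ : ∀ s : ℝ, f (I * ((1 + s : ℝ) : ℂ)) * (I * ((1 + s : ℝ) : ℂ) * y - x) ^ w * I =
      f (I + I * s) * ((I + I * s) * y - x) ^ w * I := fun s => by
    push_cast
    rw [mul_one_add]
  have e₂ : ∀ s ∈ Set.Ioi (0 : ℝ), (((1 + s) ^ 2)⁻¹ : ℝ) • (f (I * (((1 + s)⁻¹ : ℝ) : ℂ)) *
      (I * (((1 + s)⁻¹ : ℝ) : ℂ) * y - x) ^ w * I) =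
      -(g (I + I * s) * ((I + I * s) * x - -y) ^ w * I) := fun s hs => by
    have hs' : 0 < s := hs
    have him : 0 < (I + I * s).im := by simp; positivity
    have hz0 : I + I * s ≠ 0 := fun h => by simp [h] at him
    have hsq : (((1 + s) ^ 2)⁻¹ : ℝ) = -((I + I * s) ^ 2)⁻¹ := by
      rw [← mul_one_add, mul_pow, I_sq]
      push_cast
      rw [neg_one_mul, inv_neg, neg_neg]
    rw [I_mul_inv_eq, hfg _ him, Complex.real_smul, hsq]
    generalize I + I * (s : ℂ) = z at hz0
    have hlin : -1 / z * y - x = -(z * x - -y) / z := by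
      field_simp
      ring
    rw [hlin, div_pow, hw.neg_pow]
    field_simp
    ring
  have i₁ := (hf.mul_linear_pow w x y).integrableOn (τ := I) (by simp)
  have i₂ := (hg.mul_linear_pow w (-y) x).integrableOn (τ := I) (by simp)
  rw [periodPoly, (integral_Ioi_eq_add_inv ?_ ?_).2]
  · simp only [e₁]
    rw [setIntegral_congr_fun measurableSet_Ioi e₂, integral_neg, ← sub_eq_add_neg]
    have : (-1 / I : ℂ) = I := by simp [neg_div]
    rw [this]
    rfl
  · simp only [e₁]
    exact i₁.mul_const I
  · refine IntegrableOn.congr_fun ?_ (fun s hs => (e₂ s hs).symm) measurableSet_Ioi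
    exact (i₂.mul_const I).neg

theorem periodPoly_eq (hf : IsRapid f) (hg : IsRapid g) (hw : Even w)
    (hfg : ∀ z : ℂ, 0 < z.im → f (-1 / z) = z ^ (w + 2) * g z) (x y : ℂ) {τ : ℂ}
    (hτ : 0 < τ.im) :
    periodPoly f w x y = eichlerIntegral f w x y τ - eichlerIntegral g w (-y) x (-1 / τ) := by
  rw [periodPoly_eq_at_I hf hg hw hfg]
  have hgf : ∀ z : ℂ, 0 < z.im → g (-1 / z) = z ^ (w + 2) * f z := fun z hz => by
    have hz0 : z ≠ 0 := by rintro rfl; simp at hz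
    have := hfg _ (im_neg_one_div_pos hz)
    rw [show -1 / (-1 / z) = z by field_simp, div_pow, (hw.add even_two).neg_one_pow] at this
    rw [this]
    field_simp
  have hd : ∀ σ ∈ {z : ℂ | 0 < z.im}, HasDerivAt
      (fun σ => eichlerIntegral f w x y σ - eichlerIntegral g w (-y) x (-1 / σ)) 0 σ := by
    intro σ hσ
    have hσ' : 0 < σ.im := hσ
    have h0 : σ ≠ 0 := by rintro rfl; simp at hσ'
    have h₁ := (hf.mul_linear_pow w x y).hasDerivAt_verticalIntegral hσ'
    have h₂ := (hg.mul_linear_pow w (-y) x).hasDerivAt_verticalIntegral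
      (im_neg_one_div_pos hσ')
    have h₃ : HasDerivAt (fun σ : ℂ => -1 / σ) (1 / σ ^ 2) σ := by
      simpa using (hasDerivAt_const σ (-1 : ℂ)).fun_div (hasDerivAt_id σ) h0
    refine (h₁.sub (h₂.comp σ h₃)).congr_deriv ?_
    have hlin : -1 / σ * x - -y = (σ * y - x) / σ := by
      field_simp
      ring
    rw [hgf σ hσ', hlin, div_pow]
    field_simp
    ring
  exact isOpen_upperHalf.is_const_of_deriv_eq_zero (convex_halfSpace_im_gt 0).isPreconnected
    (fun σ hσ => (hd σ hσ).differentiableAt.differentiableWithinAt)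
    (fun σ hσ => (hd σ hσ).deriv) (by simp) hτ

theorem eichlerIntegral_add_one (hper : ∀ z : ℂ, 0 < z.im → f (z + 1) = f z) {x y τ : ℂ}
    (hτ : 0 < τ.im) :
    eichlerIntegral f w (x + y) y (τ + 1) = eichlerIntegral f w x y τ := by
  refine setIntegral_congr_fun measurableSet_Ioi fun t ht => ?_
  have ht' : 0 < t := ht
  have him : 0 < (τ + I * t).im := by simp; linarith
  simp only
  rw [show τ + 1 + I * t = (τ + I * t) + 1 by ring, hper _ him]
  ring_nf

theorem eichlerIntegral_trace (hf : IsRapid f) (hg : IsRapid g)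
    (htr : ∀ z : ℂ, 0 < z.im → f z + g z + g (z + 1) + g (z - 1) = 0) (x y : ℂ) {τ : ℂ}
    (hτ : 0 < τ.im) :
    eichlerIntegral f w x y τ + eichlerIntegral g w x y τ +
      eichlerIntegral g w (x + y) y (τ + 1) + eichlerIntegral g w (x - y) y (τ - 1) = 0 := by
  have i₀ := ((hf.mul_linear_pow w x y).integrableOn hτ).mul_const I
  have i₁ := ((hg.mul_linear_pow w x y).integrableOn hτ).mul_const I
  have i₂ := ((hg.mul_linear_pow w (x + y) y).integrableOn (τ := τ + 1) (by simpa)).mul_const I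
  have i₃ := ((hg.mul_linear_pow w (x - y) y).integrableOn (τ := τ - 1) (by simpa)).mul_const I
  simp only [eichlerIntegral, verticalIntegral]
  rw [← integral_add i₀ i₁, ← integral_add (i₀.fun_add i₁) i₂,
    ← integral_add ((i₀.fun_add i₁).fun_add i₂) i₃]
  refine setIntegral_eq_zero_of_forall_eq_zero fun t ht => ?_
  have ht' : 0 < t := ht
  have him : 0 < (τ + I * t).im := by simp; linarith
  have := htr _ him
  rw [show τ + 1 + I * t = (τ + I * t) + 1 by ring, show τ - 1 + I * t = (τ + I * t) - 1 by ring]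
  linear_combination ((τ + I * t) * y - x) ^ w * I * this

theorem eichlerIntegral_neg_neg (hw : Even w) (x y τ : ℂ) :
    eichlerIntegral f w (-x) (-y) τ = eichlerIntegral f w x y τ := by
  have : ∀ z : ℂ, (z * -y - -x) ^ w = (z * y - x) ^ w := fun z => by
    rw [← hw.neg_pow]
    ring
  simp only [eichlerIntegral, this]

theorem periodPoly_relation (hf : IsRapid f) (hg : IsRapid g) (hw : Even w)
    (hfg : ∀ z : ℂ, 0 < z.im → f (-1 / z) = z ^ (w + 2) * g z)
    (hper : ∀ z : ℂ, 0 < z.im → f (z + 1) = f z)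
    (htr : ∀ z : ℂ, 0 < z.im → f z + g z + g (z + 1) + g (z - 1) = 0) (x y : ℂ) :
    periodPoly f w x y - periodPoly f w (-y) x + periodPoly f w x (x + y)
      - periodPoly f w (-y) (x + y) + periodPoly f w x (y - x) - periodPoly f w y (y - x) = 0 := by
  have P := fun (x y : ℂ) {τ : ℂ} => periodPoly_eq (τ := τ) hf hg hw hfg x y
  have N := fun (h : ℂ → ℂ) (x y τ : ℂ) => eichlerIntegral_neg_neg (f := h) hw x y τ
  have hI : (-1 / I : ℂ) = I := by simp [neg_div]
  have h₁ : 0 < (-1 / (I + 1)).im := im_neg_one_div_pos (by simp)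
  have h₂ : 0 < (-1 / (I - 1)).im := im_neg_one_div_pos (by simp)
  have n₁ : I + 1 ≠ 0 := fun h => by simpa using congrArg Complex.im h
  have n₂ : I - 1 ≠ 0 := fun h => by simpa using congrArg Complex.im h
  have t₁ := eichlerIntegral_trace (w := w) hf hg htr x y (τ := I) (by simp)
  have t₂ := eichlerIntegral_trace (w := w) hf hg htr (-y) x (τ := I) (by simp)
  have p₁ := P x y (τ := I) (by simp)
  have p₂ := P (-y) x (τ := I) (by simp)
  have p₃ := P x (x + y) (τ := -1 / (I + 1) + 1) (by simpa using h₁)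
  have p₄ := P (-y) (x + y) h₁
  have p₅ := P x (y - x) (τ := -1 / (I - 1) - 1) (by simpa using h₂)
  have p₆ := P y (y - x) h₂
  have s₁ := eichlerIntegral_add_one (w := w) hper (x := -y) (y := x + y) h₁
  have s₂ := eichlerIntegral_add_one (w := w) hper (x := x) (y := y - x)
    (τ := -1 / (I - 1) - 1) (by simpa using h₂)
  have q₁ : -1 / (-1 / (I + 1)) = I + 1 := by field_simp
  have q₂ : -1 / (-1 / (I - 1)) = I - 1 := by field_simp
  have q₃ : -1 / (-1 / (I + 1) + 1) = I - 1 := by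
    rw [show -1 / (I + 1) + 1 = I / (I + 1) by field_simp; ring]
    field_simp
    linear_combination -I_sq
  have q₄ : -1 / (-1 / (I - 1) - 1) = I + 1 := by
    rw [show -1 / (I - 1) - 1 = -I / (I - 1) by field_simp; ring]
    field_simp
    linear_combination -I_sq
  rw [hI] at p₁ p₂
  rw [N] at p₂
  rw [q₃, show -(x + y) = -y - x by ring] at p₃
  rw [q₁, N] at p₄
  rw [q₄, show -(y - x) = -y + x by ring] at p₅
  rw [q₂, neg_sub] at p₆
  rw [show -y + (x + y) = x by ring] at s₁
  rw [add_sub_cancel, sub_add_cancel] at s₂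
  linear_combination p₁ - p₂ + p₃ - p₄ + p₅ - p₆ + t₁ - t₂ + s₁ - s₂

end

section

variable {f g : ℂ → ℂ} {w : ℕ}

theorem integrableOn_mul_pow (hf : IsRapid f) (hg : IsRapid g)
    (hfg : ∀ z : ℂ, 0 < z.im → f (-1 / z) = z ^ (w + 2) * g z) {j : ℕ} (hj : j ≤ w) :
    IntegrableOn (fun t : ℝ => f (I * t) * (t : ℂ) ^ j) (Set.Ioi 0) := by
  have hu : ∀ s : ℝ, (I + I * s) * -I - 0 = 1 + s := fun s => by
    linear_combination (-1 - s : ℂ) * I_sq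
  refine (integral_Ioi_eq_add_inv ?_ ?_).1
  · refine IntegrableOn.congr_fun ((hf.mul_linear_pow j 0 (-I)).integrableOn (τ := I) (by simp))
      (fun s _ => ?_) measurableSet_Ioi
    simp only [hu]
    push_cast
    rw [mul_one_add]
  · refine IntegrableOn.congr_fun (((hg.mul_linear_pow (w - j) 0 (-I)).integrableOn (τ := I)
      (by simp)).const_mul (I ^ (w + 2))) (fun s hs => ?_) measurableSet_Ioi
    have hs' : 0 < s := hs
    have him : 0 < (I + I * s).im := by simp; positivity
    have h1 : (1 + s : ℂ) ≠ 0 := by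
      have : (1 + s : ℝ) ≠ 0 := by positivity
      exact_mod_cast this
    obtain ⟨d, rfl⟩ := Nat.exists_eq_add_of_le hj
    simp only [hu]
    rw [I_mul_inv_eq, hfg _ him, Complex.real_smul]
    push_cast
    rw [show (I + I * s : ℂ) = I * (1 + s) by ring, mul_pow, Nat.add_sub_cancel_left, inv_pow]
    field_simp
    ring

theorem periodPoly_eq_sum (hf : IsRapid f) (hg : IsRapid g)
    (hfg : ∀ z : ℂ, 0 < z.im → f (-1 / z) = z ^ (w + 2) * g z) (x y : ℂ) :
    periodPoly f w x y = ∑ j ∈ Finset.range (w + 1),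
      (Nat.choose w j * I ^ (j + 1) * ∫ t in Set.Ioi (0 : ℝ), f (I * t) * (t : ℂ) ^ j) *
        (y ^ j * (-x) ^ (w - j)) := by
  have he : ∀ t : ℝ, f (I * t) * (I * t * y - x) ^ w * I = ∑ j ∈ Finset.range (w + 1),
      Nat.choose w j * I ^ (j + 1) * (y ^ j * (-x) ^ (w - j)) * (f (I * t) * (t : ℂ) ^ j) := by
    intro t
    rw [sub_eq_add_neg, add_pow, Finset.mul_sum, Finset.sum_mul]
    refine Finset.sum_congr rfl fun j _ => ?_
    ring
  simp only [periodPoly, he]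
  rw [integral_finsetSum _ fun j hj => (integrableOn_mul_pow hf hg hfg
    (Nat.lt_succ_iff.1 (Finset.mem_range.1 hj))).const_mul _]
  refine Finset.sum_congr rfl fun j _ => ?_
  rw [integral_const_mul]
  ring

end

open Polynomial in
theorem coeff_even_period_relation {w i j : ℕ} (hw : Even w) (hi : Even i) (hiw : i ≤ w) (hj : Even j)
    (hjw : j ≤ w) :
    ((X ^ i - X ^ (w - i) + (X + C 1) ^ i + (X - C 1) ^ i - (X + C 1) ^ i * X ^ (w - i)
      - (X - C 1) ^ i * X ^ (w - i) : ℂ[X])).coeff j =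
      (if i = j then 1 else 0) - (if i = w - j then 1 else 0) +
        2 * ((i.choose j : ℂ) - i.choose (w - j)) := by
  have hs : ∀ l, Even (i - l) → ((X - C 1 : ℂ[X]) ^ i).coeff l = i.choose l := fun l hl => by
    rw [sub_eq_add_neg, ← C_neg, coeff_X_add_C_pow, hl.neg_one_pow, one_mul]
  have h₁ : ((X - C 1 : ℂ[X]) ^ i).coeff j = i.choose j := hs j (hi.tsub hj)
  have h₂ : ((X + C 1 : ℂ[X]) ^ i).coeff j = i.choose j := by
    rw [coeff_X_add_C_pow, one_pow, one_mul]
  have hc : w - i ≤ j → i.choose (j - (w - i)) = i.choose (w - j) := fun h => by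
    rw [← Nat.choose_symm (show w - j ≤ i by omega)]
    congr 1
    omega
  have hc' : ¬ w - i ≤ j → i.choose (w - j) = 0 := fun h => Nat.choose_eq_zero_of_lt (by omega)
  simp only [coeff_sub, coeff_add, coeff_mul_X_pow', coeff_X_pow, h₁, h₂]
  simp only [show j = i ↔ i = j by omega, show j = w - i ↔ i = w - j by omega]
  by_cases h : w - i ≤ j
  · rw [if_pos h, if_pos h, hs _ (by
      rw [show i - (j - (w - i)) = w - j by omega]; exact hw.tsub hj), coeff_X_add_C_pow,
      one_pow, one_mul, hc h]
    ring
  · rw [if_neg h, if_neg h, hc' h]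
    push_cast
    ring

theorem even_coeff_relation {w : ℕ} (hw : Even w) {b : ℕ → ℂ} {p : ℂ → ℂ → ℂ}
    (hp : ∀ x y, p x y = ∑ i ∈ Finset.range (w + 1), b i * (y ^ i * (-x) ^ (w - i)))
    (hrel : ∀ x y, p x y - p (-y) x + p x (x + y) - p (-y) (x + y) + p x (y - x)
      - p y (y - x) = 0) {j : ℕ} (hj : Even j) (hjw : j ≤ w) :
    ∑ i ∈ Finset.range (w + 1) with Even i, b i * ((if i = j then 1 else 0) -
      (if i = w - j then 1 else 0) + 2 * ((i.choose j : ℂ) - i.choose (w - j))) = 0 := by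
  set E : ℂ → ℂ → ℂ := fun x y =>
    ∑ i ∈ Finset.range (w + 1) with Even i, b i * (y ^ i * x ^ (w - i)) with hE
  have hpE : ∀ x y, p x y + p (-x) y = 2 * E x y := fun x y => by
    rw [hp, hp, hE, ← Finset.sum_add_distrib, Finset.mul_sum, Finset.sum_filter]
    refine Finset.sum_congr rfl fun i hi => ?_
    have hiw : i ≤ w := Nat.lt_succ_iff.1 (Finset.mem_range.1 hi)
    split_ifs with h
    · rw [neg_neg, (hw.tsub h).neg_pow]
      ring
    · rw [neg_neg, (Nat.Even.sub_odd hiw hw (Nat.not_even_iff_odd.1 h)).neg_pow]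
      ring
  have hneg : ∀ x y, p (-x) (-y) = p x y := fun x y => by
    rw [hp, hp]
    refine Finset.sum_congr rfl fun i hi => ?_
    have hiw : i ≤ w := Nat.lt_succ_iff.1 (Finset.mem_range.1 hi)
    obtain ⟨d, rfl⟩ := Nat.exists_eq_add_of_le hiw
    have h1 : (-1 : ℂ) ^ (i + d) = 1 := hw.neg_one_pow
    rw [Nat.add_sub_cancel_left, neg_pow y, neg_pow (-x)]
    linear_combination b i * y ^ i * (-x) ^ d * h1
  have hErel : ∀ y, E 1 y - E y 1 + E 1 (y + 1) + E 1 (y - 1) - E y (y + 1) - E y (y - 1) = 0 := by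
    intro y
    have h₁ := hrel 1 y
    have h₂ := hrel (-1) y
    have n₁ := hneg y 1
    rw [add_comm 1 y] at h₁
    rw [neg_add_eq_sub, sub_neg_eq_add, n₁] at h₂
    linear_combination (h₁ + h₂ - hpE 1 y + hpE y 1 - hpE 1 (y + 1) - hpE 1 (y - 1)
      + hpE y (y + 1) + hpE y (y - 1)) / 2
  have hpoly : ∑ i ∈ Finset.range (w + 1) with Even i, Polynomial.C (b i) *
      (.X ^ i - .X ^ (w - i) + (.X + .C 1) ^ i + (.X - .C 1) ^ i - (.X + .C 1) ^ i * .X ^ (w - i)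
        - (.X - .C 1) ^ i * .X ^ (w - i)) = 0 := by
    refine Polynomial.funext fun y => ?_
    rw [Polynomial.eval_zero, ← hErel y]
    simp only [hE, Polynomial.eval_finsetSum, ← Finset.sum_sub_distrib, ← Finset.sum_add_distrib]
    refine Finset.sum_congr rfl fun i _ => ?_
    simp only [Polynomial.eval_mul, Polynomial.eval_sub, Polynomial.eval_add, Polynomial.eval_pow,
      Polynomial.eval_X, Polynomial.eval_C]
    ring
  have hcoeff := congrArg (Polynomial.coeff · j) hpoly
  simp only [Polynomial.finsetSum_coeff, Polynomial.coeff_zero] at hcoeff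
  refine (Finset.sum_congr rfl fun i hi => ?_).trans hcoeff
  rw [Finset.mem_filter, Finset.mem_range, Nat.lt_succ_iff] at hi
  rw [Polynomial.coeff_C_mul, coeff_even_period_relation hw hi.2 hi.1 hj hjw]

theorem integral_mul_pow_of_atkinLehner {k : ℕ} {c : ℂ} {F : ℂ → ℂ}
    (hF : ∀ z : ℂ, 0 < z.im → F (-1 / (3 * z)) = c * z ^ k * F z) {j l : ℕ} (hjl : j + l + 2 = k) :
    ∫ t in Set.Ioi (0 : ℝ), F (I * t) * (t : ℂ) ^ j =
      c * I ^ k * (3 ^ (j + 1))⁻¹ * ∫ t in Set.Ioi (0 : ℝ), F (I * t) * (t : ℂ) ^ l := by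
  have him : (fun s : ℝ => (3 * s)⁻¹) '' Set.Ioi 0 = Set.Ioi 0 := by
    ext t
    simp only [Set.mem_image, Set.mem_Ioi]
    refine ⟨fun ⟨s, hs, h⟩ => h ▸ by positivity, fun ht => ⟨(3 * t)⁻¹, by positivity, ?_⟩⟩
    field_simp
  have hd : ∀ s ∈ Set.Ioi (0 : ℝ),
      HasDerivWithinAt (fun s : ℝ => (3 * s)⁻¹) (-3 / (3 * s) ^ 2) (Set.Ioi 0) s := fun s hs => by
    have hs' : 0 < s := hs
    simpa using (((hasDerivAt_id s).const_mul 3).fun_inv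
      (by simp only [id]; positivity)).hasDerivWithinAt
  have hinj : Set.InjOn (fun s : ℝ => (3 * s)⁻¹) (Set.Ioi 0) := fun a _ b _ h => by
    simpa using h
  have he := integral_image_eq_integral_abs_deriv_smul measurableSet_Ioi hd hinj
    fun t => F (I * t) * (t : ℂ) ^ j
  rw [him] at he
  rw [he, ← integral_const_mul]
  refine setIntegral_congr_fun measurableSet_Ioi fun s hs => ?_
  have hs' : 0 < s := hs
  have hs0 : (s : ℂ) ≠ 0 := by exact_mod_cast hs'.ne'
  have harg : I * (((3 * s)⁻¹ : ℝ) : ℂ) = -1 / (3 * (I * s)) := by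
    push_cast
    field_simp
    rw [I_sq]
  rw [harg, hF _ (by simpa using hs'), abs_div, abs_neg, abs_of_pos (by positivity : (0 : ℝ) < 3),
    abs_of_pos (by positivity : (0 : ℝ) < (3 * s) ^ 2), Complex.real_smul, ← hjl]
  push_cast
  rw [inv_pow, mul_pow I]
  field_simp
  ring

theorem mem_oo {k : ℕ} {m : ℕ × ℕ} :
    m ∈ oo k ↔ Odd m.1 ∧ Odd m.2 ∧ 3 ≤ m.1 ∧ 3 ≤ m.2 ∧ m.1 + m.2 = k := by
  simp only [oo, Finset.mem_filter, Finset.mem_product, Finset.mem_range]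
  refine ⟨And.right, fun h => ⟨?_, h⟩⟩
  omega

theorem ichoose_pred_sub {m n : ℕ} (hm : 0 < m) (hn : 0 < n) :
    ichoose ((m : ℤ) - 1) ((m : ℤ) - n) = (m - 1).choose (n - 1) := by
  obtain ⟨a, rfl⟩ := Nat.exists_eq_add_of_lt hm
  obtain ⟨b, rfl⟩ := Nat.exists_eq_add_of_lt hn
  by_cases h : b ≤ a
  · rw [ichoose, if_pos (by omega),
      show (((0 + a + 1 : ℕ) : ℤ) - 1).toNat = a by omega,
      show (((0 + a + 1 : ℕ) : ℤ) - ((0 + b + 1 : ℕ) : ℤ)).toNat = a - b by omega,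
      Nat.choose_symm h, show 0 + a + 1 - 1 = a by omega, show 0 + b + 1 - 1 = b by omega]
  · rw [ichoose, if_neg (by omega), Nat.choose_eq_zero_of_lt (by omega), Nat.cast_zero]

theorem eEntry_eq_of_odd {m n : ℕ × ℕ} (hm : Odd m.1) (hn₁ : Odd n.1) (hn₂ : Odd n.2) :
    eEntry m n = (m.1 - 1).choose (n.2 - 1) - (m.1 - 1).choose (n.1 - 1) := by
  have hsub : Even ((m.1 : ℤ) - n.2) := (hm.natCast (R := ℤ)).sub_odd hn₂.natCast
  rw [eEntry, ichoose_pred_sub hm.pos hn₁.pos, ichoose_pred_sub hm.pos hn₂.pos, zpow_natCast,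
    hn₁.neg_one_pow, hsub.neg_one_zpow]
  push_cast
  ring

theorem sum_oo_eq_sum_range {w : ℕ} (hw : Even w) {F : ℕ → ℂ} (h0 : F 0 = 0) (hFw : F w = 0) :
    ∑ m ∈ oo (w + 2), F (m.1 - 1) = ∑ i ∈ Finset.range (w + 1) with Even i, F i := by
  refine Finset.sum_of_injOn (fun m => m.1 - 1) ?_ ?_ ?_ fun _ _ => rfl
  · intro m hm n hn h
    rw [Finset.mem_coe, mem_oo] at hm hn
    simp only at h
    ext <;> omega
  · intro m hm
    rw [Finset.mem_coe, mem_oo] at hm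
    rw [Finset.mem_coe, Finset.mem_filter, Finset.mem_range]
    exact ⟨show m.1 - 1 < w + 1 by omega, hm.1.tsub_odd odd_one⟩
  · intro i hi hni
    rw [Finset.mem_filter, Finset.mem_range] at hi
    by_contra hF
    have hi0 : i ≠ 0 := by rintro rfl; exact hF h0
    have hiw : i ≠ w := by rintro rfl; exact hF hFw
    refine hni ⟨(i + 1, w - i + 1), ?_, rfl⟩
    have hd := hw.tsub hi.2
    rw [Finset.mem_coe, mem_oo]
    refine ⟨hi.2.add_one, hd.add_one, ?_, ?_, ?_⟩
    · obtain ⟨a, ha⟩ := hi.2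
      simp only
      omega
    · obtain ⟨a, ha⟩ := hd
      simp only
      omega
    · simp only
      omega

theorem periodCoeff_sum_relation {w : ℕ} (hw : Even w) {f : UpperHalfPlane → ℂ} {g : ℂ → ℂ}
    (hf : IsRapid (fval f)) (hg : IsRapid g)
    (hfg : ∀ z : ℂ, 0 < z.im → fval f (-1 / z) = z ^ (w + 2) * g z)
    (hper : ∀ z : ℂ, 0 < z.im → fval f (z + 1) = fval f z)
    (htr : ∀ z : ℂ, 0 < z.im → fval f z + g z + g (z + 1) + g (z - 1) = 0)
    {n : ℕ × ℕ} (hn : n ∈ oo (w + 2)) :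
    ∑ m ∈ oo (w + 2), periodCoeff (w + 2) f m.1 * (eEntry m n : ℂ) =
      (periodCoeff (w + 2) f n.1 - periodCoeff (w + 2) f n.2) / 2 := by
  obtain ⟨hn₁, hn₂, h₁, h₂, hsum⟩ := mem_oo.1 hn
  have hwn : w - (n.2 - 1) = n.1 - 1 := by omega
  have key := even_coeff_relation hw
    (b := fun i => periodCoeff (w + 2) f (i + 1)) (periodPoly_eq_sum hf hg hfg)
    (periodPoly_relation hf hg hw hfg hper htr) (hn₂.tsub_odd odd_one)
    (show n.2 - 1 ≤ w by omega)
  rw [hwn] at key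
  have hconv := sum_oo_eq_sum_range hw (F := fun i => periodCoeff (w + 2) f (i + 1) *
      ((i.choose (n.2 - 1) : ℂ) - i.choose (n.1 - 1)))
    (by simp [Nat.choose_eq_zero_of_lt (show 0 < n.2 - 1 by omega),
      Nat.choose_eq_zero_of_lt (show 0 < n.1 - 1 by omega)])
    (by rw [← hwn, Nat.choose_symm (show n.2 - 1 ≤ w by omega), sub_self, mul_zero])
  have hmem : ∀ j, Odd j → j ≤ w + 1 → j - 1 ∈ (Finset.range (w + 1)).filter Even := fun j hj h => by
    rw [Finset.mem_filter, Finset.mem_range]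
    exact ⟨by omega, hj.tsub_odd odd_one⟩
  have hsplit : ∀ (b c : ℕ → ℂ) (j l : ℕ), ∑ i ∈ Finset.range (w + 1) with Even i,
      b i * ((if i = j then 1 else 0) - (if i = l then 1 else 0) + 2 * c i) =
      (∑ i ∈ Finset.range (w + 1) with Even i, if i = j then b i else 0) -
      (∑ i ∈ Finset.range (w + 1) with Even i, if i = l then b i else 0) +
      2 * ∑ i ∈ Finset.range (w + 1) with Even i, b i * c i := fun b c j l => by
    rw [Finset.mul_sum, ← Finset.sum_sub_distrib, ← Finset.sum_add_distrib]
    refine Finset.sum_congr rfl fun i _ => ?_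
    split_ifs <;> ring
  rw [hsplit, ← hconv, Finset.sum_ite_eq', Finset.sum_ite_eq', if_pos (hmem n.2 hn₂ (by omega)),
    if_pos (hmem n.1 hn₁ (by omega)), Nat.sub_add_cancel (show 1 ≤ n.2 by omega),
    Nat.sub_add_cancel (show 1 ≤ n.1 by omega)] at key
  rw [eq_div_iff two_ne_zero, mul_comm, ← sub_eq_zero, ← key]
  have : ∑ m ∈ oo (w + 2), periodCoeff (w + 2) f m.1 * (eEntry m n : ℂ) =
      ∑ m ∈ oo (w + 2), periodCoeff (w + 2) f (m.1 - 1 + 1) *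
        (((m.1 - 1).choose (n.2 - 1) : ℂ) - (m.1 - 1).choose (n.1 - 1)) :=
    Finset.sum_congr rfl fun m hm => by
      have hm₁ := (mem_oo.1 hm).1
      rw [eEntry_eq_of_odd hm₁ hn₁ hn₂, Nat.sub_add_cancel hm₁.pos]
      push_cast
      rfl
  rw [this]
  ring

theorem periodCoeff_of_atkinLehner {q : ℕ} {ε : ℂ} {f : UpperHalfPlane → ℂ}
    (hAL : ∀ z : ℂ, 0 < z.im →
      fval f (-1 / (3 * z)) = ε * 3 ^ (q + 1) * z ^ (2 * q + 2) * fval f z)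
    {n : ℕ × ℕ} (hn : n ∈ oo (2 * q + 2)) :
    (3 : ℂ) ^ (1 - (n.2 : ℤ)) * periodCoeff (2 * q + 2) f n.1 =
      -ε * ((3 : ℂ) ^ q)⁻¹ * periodCoeff (2 * q + 2) f n.2 := by
  obtain ⟨hn₁, hn₂, h₁, h₂, hsum⟩ := mem_oo.1 hn
  obtain ⟨n₁, n₂⟩ := n
  obtain ⟨j, rfl⟩ := Nat.exists_eq_add_of_le' (show 1 ≤ n₁ by simp only at h₁; omega)
  obtain ⟨l, rfl⟩ := Nat.exists_eq_add_of_le' (show 1 ≤ n₂ by simp only at h₂; omega)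
  simp only at hn₁ hsum ⊢
  have hjl : 2 * q = j + l := by omega
  have hchoose : (2 * q).choose j = (2 * q).choose l := by
    rw [hjl, Nat.choose_symm_add]
  have hI : I ^ (j + 1) * I ^ (2 * q + 2) = -I ^ (l + 1) := by
    have h1 : (I ^ (j + 1)) ^ 2 = -1 := by rw [pow_right_comm, I_sq, hn₁.neg_one_pow]
    rw [show 2 * q + 2 = (j + 1) + (l + 1) by omega, pow_add I (j + 1)]
    linear_combination I ^ (l + 1) * h1
  have h3 : (3 : ℂ) ^ (1 - ((l + 1 : ℕ) : ℤ)) = (3 ^ l)⁻¹ := by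
    rw [show 1 - ((l + 1 : ℕ) : ℤ) = -(l : ℤ) by push_cast; ring, zpow_neg, zpow_natCast]
  have hpow : (3 : ℂ) ^ l * 3 ^ j = 3 ^ q * 3 ^ q := by
    rw [← pow_add, ← pow_add, ← two_mul, hjl, add_comm]
  rw [periodCoeff, periodCoeff, Nat.add_sub_cancel, Nat.add_sub_cancel, Nat.add_sub_cancel, h3,
    hchoose, integral_mul_pow_of_atkinLehner hAL (show j + l + 2 = 2 * q + 2 by omega)]
  have h3' : ((3 : ℂ) ^ l)⁻¹ * (3 ^ (q + 1) * (3 ^ (j + 1))⁻¹) = (3 ^ q)⁻¹ := by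
    field_simp
    rw [pow_succ, pow_succ]
    linear_combination -3 * hpow
  generalize (∫ t in Set.Ioi (0 : ℝ), fval f (I * t) * (t : ℂ) ^ l) = L
  linear_combination ((2 * q).choose l * L * ε) * (I ^ (j + 1) * I ^ (2 * q + 2)) * h3' +
    ((2 * q).choose l * L * ε) * (3 ^ q)⁻¹ * hI

/-- Theorem (connection with newforms of level `Γ₀(3)`): the coefficient vector of the
restricted even period polynomial of an Atkin–Lehner eigenform `f` of weight `k` for
`Γ₀(3)` satisfying the newform relation is a left eigenvector of `D³_{k,2} ⬝ C³_{k,2}`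
with eigenvalue `-(1/2)(1 + ε ⬝ 3^{-(k-2)/2})`. -/
theorem stmt3 (k : ℕ) (hk : 6 ≤ k) (hke : Even k) (ε : ℂ) (hε : ε = 1 ∨ ε = -1)
    (f : CuspForm (Gamma0 3) (k : ℤ))
    (hAL : ∀ z : ℂ, 0 < z.im →
      ((3 : ℂ) ^ (k / 2))⁻¹ * z ^ (-(k : ℤ)) * fval f (-1 / (3 * z)) = ε * fval f z)
    (hnew : ∀ z : ℂ, 0 < z.im →
      (1 / 3) * (fval f (z / 3) + fval f ((z + 1) / 3) + fval f ((z + 2) / 3))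
        = -ε * 3 ^ ((k - 2) / 2) * fval f z) :
    ∀ n ∈ oo k, ∑ m ∈ oo k, periodCoeff k f m.1 * (dc3Entry m n : ℂ)
      = -(1 / 2) * (1 + ε * ((3 : ℂ) ^ ((k - 2) / 2))⁻¹) * periodCoeff k f n.2 := by
  obtain ⟨q, rfl⟩ : ∃ q, k = 2 * q + 2 := by
    obtain ⟨a, rfl⟩ := hke
    exact ⟨a - 1, by omega⟩
  have hq₁ : (2 * q + 2) / 2 = q + 1 := by omega
  have hq₂ : (2 * q + 2 - 2) / 2 = q := by omega
  rw [hq₁] at hAL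
  rw [hq₂] at hnew ⊢
  have hε2 : ε * ε = 1 := by rcases hε with rfl | rfl <;> norm_num
  have hAL' : ∀ z : ℂ, 0 < z.im →
      fval f (-1 / (3 * z)) = ε * 3 ^ (q + 1) * z ^ (2 * q + 2) * fval f z := fun z hz => by
    have hz0 : z ≠ 0 := by rintro rfl; simp at hz
    have h := hAL z hz
    rw [zpow_neg, zpow_natCast] at h
    field_simp at h
    rw [neg_div]
    linear_combination h
  set g : ℂ → ℂ := fun z => ε * (3 ^ (q + 1))⁻¹ * fval f (z / 3) with hg
  have hdiv : ∀ z : ℂ, 0 < z.im → 0 < (z / 3).im := fun z hz => by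
    rw [show z / 3 = z / (3 : ℝ) by norm_num, Complex.div_ofReal_im]
    positivity
  have hfg : ∀ z : ℂ, 0 < z.im → fval f (-1 / z) = z ^ (2 * q + 2) * g z := fun z hz => by
    have h := hAL' (z / 3) (hdiv z hz)
    rw [mul_div_cancel₀ z three_ne_zero] at h
    rw [h, hg, div_pow, show (3 : ℂ) ^ (2 * q + 2) = 3 ^ (q + 1) * 3 ^ (q + 1) by ring]
    field_simp
  have htr : ∀ z : ℂ, 0 < z.im → fval f z + g z + g (z + 1) + g (z - 1) = 0 := fun z hz => by
    have h := hnew z hz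
    have hp := fval_add_one f (z := (z - 1) / 3) (hdiv _ (by simpa using hz))
    rw [show (z - 1) / 3 + 1 = (z + 2) / 3 by ring] at hp
    rw [hp] at h
    simp only [hg, pow_succ]
    have h3 : ((3 : ℂ) ^ q)⁻¹ * 3 ^ q = 1 := inv_mul_cancel₀ (pow_ne_zero q three_ne_zero)
    rw [mul_inv]
    linear_combination ε * (3 ^ q)⁻¹ * h - ε * ε * fval f z * h3 - fval f z * hε2
  intro n hn
  have hrapid := isRapid_fval f
  have key := periodCoeff_sum_relation (even_two_mul q) hrapid
    (hrapid.const_mul_comp_div_three _) hfg (fun z hz => fval_add_one f hz) htr hn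
  have hal := periodCoeff_of_atkinLehner hAL' hn
  have hsum : ∑ m ∈ oo (2 * q + 2), periodCoeff (2 * q + 2) f m.1 * (dc3Entry m n : ℂ) =
      ∑ m ∈ oo (2 * q + 2), (if m = n then
        periodCoeff (2 * q + 2) f m.1 * (((3 : ℂ) ^ (1 - (m.2 : ℤ)) - 1) / 2) else 0) +
      ∑ m ∈ oo (2 * q + 2), periodCoeff (2 * q + 2) f m.1 * (eEntry m n : ℂ) := by
    rw [← Finset.sum_add_distrib]
    refine Finset.sum_congr rfl fun m _ => ?_
    rw [dc3Entry, deltaEntry]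
    split_ifs <;> push_cast <;> ring
  rw [hsum, key, Finset.sum_ite_eq', if_pos hn]
  linear_combination hal / 2
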